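/- Let B = {d₁,…,d₈} ⊆ E₁₀ be roots whose intersection pattern is the D₈ Dynkin diagram, i.e. d₁·d₃ = d₂·d₃ = 1, dᵢ·dᵢ₊₁ = 1 for 3 ≤ i ≤ 7, and all other products of distinct elements are 0. Let R be the sublattice generated by B and R' = (R ⊗ ℚ) ∩ E₁₀ its primitive closure, and assume [R' : R] = 2 (so B is of type (D₈, E₈)). Then every isometry of (F₂^10, q) that maps B̄ to itself setwise and R̄' to itself setwise fixes every element of B̄. -/

import Mathlib

open Matrix

/-- The Gram matrix of the `E₁₀` lattice. -/
def e10Gram : Matrix (Fin 10) (Fin 10) ℤ :=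
  Matrix.of fun i j =>
    if i = j then -2
    else if (i.val + 1 = j.val ∧ j.val ≤ 8) ∨ (j.val + 1 = i.val ∧ i.val ≤ 8) then 1
    else if (i.val = 6 ∧ j.val = 9) ∨ (i.val = 9 ∧ j.val = 6) then 1
    else 0

/-- The even unimodular bilinear form of signature `(1,9)` on `E₁₀ = ℤ^10`. -/
def e10Form (x y : Fin 10 → ℤ) : ℤ := x ⬝ᵥ e10Gram.mulVec y

/-- Reduction mod 2, `E₁₀ → E₁₀ ⊗ F₂ = F₂^10`. -/
def red (x : Fin 10 → ℤ) : Fin 10 → ZMod 2 := fun i => (x i : ZMod 2)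

/-- The quadratic form `q(x̄) = (x·x)/2 mod 2` on `E₁₀ ⊗ F₂`. -/
def q2 (v : Fin 10 → ZMod 2) : ZMod 2 :=
  ((e10Form (fun i => ((v i).val : ℤ)) (fun i => ((v i).val : ℤ)) / 2 : ℤ) : ZMod 2)

/-- Adjacency in the `D₈` Dynkin diagram (zero-indexed: `d₀`,`d₁` are the two short
arms attached to `d₂`, and `d₂, …, d₇` form a chain); the statement is 1-indexed, so
`d₁·d₃ = d₂·d₃ = 1` and `dᵢ·dᵢ₊₁ = 1` for `3 ≤ i ≤ 7`. -/
def d8Adj (i j : ℕ) : Prop :=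
  (i = 0 ∧ j = 2) ∨ (j = 0 ∧ i = 2) ∨ (i = 1 ∧ j = 2) ∨ (j = 1 ∧ i = 2) ∨
    (2 ≤ i ∧ i + 1 = j) ∨ (2 ≤ j ∧ j + 1 = i)

instance (i j : ℕ) : Decidable (d8Adj i j) := by unfold d8Adj; infer_instance
/-- The quadratic form `(x·x)/2` of `E₁₀` with coefficients in a commutative ring. -/
def e10Quad {A : Type*} [CommRing A] (x : Fin 10 → A) : A :=
  x 0 * x 1 + x 1 * x 2 + x 2 * x 3 + x 3 * x 4 + x 4 * x 5 + x 5 * x 6 + x 6 * x 7 +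
    x 7 * x 8 + x 6 * x 9 - ∑ i, x i ^ 2

theorem e10Form_eq (x y : Fin 10 → ℤ) : e10Form x y =
    x 0 * y 1 + x 1 * y 0 + (x 1 * y 2 + x 2 * y 1) + (x 2 * y 3 + x 3 * y 2) +
    (x 3 * y 4 + x 4 * y 3) + (x 4 * y 5 + x 5 * y 4) + (x 5 * y 6 + x 6 * y 5) +
    (x 6 * y 7 + x 7 * y 6) + (x 7 * y 8 + x 8 * y 7) + (x 6 * y 9 + x 9 * y 6) -
    2 * ∑ i, x i * y i := by
  have hG : e10Gram = !![-2,1,0,0,0,0,0,0,0,0; 1,-2,1,0,0,0,0,0,0,0; 0,1,-2,1,0,0,0,0,0,0;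
      0,0,1,-2,1,0,0,0,0,0; 0,0,0,1,-2,1,0,0,0,0; 0,0,0,0,1,-2,1,0,0,0;
      0,0,0,0,0,1,-2,1,0,1; 0,0,0,0,0,0,1,-2,1,0; 0,0,0,0,0,0,0,1,-2,0;
      0,0,0,0,0,0,1,0,0,-2] := by
    decide
  simp only [e10Form, hG, dotProduct, mulVec, Fin.sum_univ_succ, Finset.univ_eq_empty,
    Finset.sum_empty, Matrix.of_apply, Matrix.cons_val_zero, Matrix.cons_val_succ,
    Matrix.cons_val_fin_one]
  simp only [Fin.succ_zero_eq_one, Fin.succ_one_eq_two, Fin.reduceSucc]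
  ring

theorem e10Form_self (x : Fin 10 → ℤ) : e10Form x x = 2 * e10Quad x := by
  simp only [e10Form_eq, e10Quad, ← sq]
  ring

theorem e10Form_add_left (x y z : Fin 10 → ℤ) :
    e10Form (x + y) z = e10Form x z + e10Form y z := by
  simp only [e10Form, add_dotProduct]

theorem e10Form_smul_left (a : ℤ) (x z : Fin 10 → ℤ) :
    e10Form (a • x) z = a * e10Form x z := by
  simp only [e10Form, smul_dotProduct, smul_eq_mul]

theorem e10Form_sum_smul_left {ι : Type*} [Fintype ι] (c : ι → ℤ) (d : ι → Fin 10 → ℤ)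
    (z : Fin 10 → ℤ) : e10Form (∑ i, c i • d i) z = ∑ i, c i * e10Form (d i) z := by
  simp only [e10Form, sum_dotProduct, smul_dotProduct, smul_eq_mul]

theorem e10Quad_add (x y : Fin 10 → ℤ) :
    e10Quad (x + y) = e10Quad x + e10Quad y + e10Form x y := by
  simp only [e10Form_eq, e10Quad, Pi.add_apply, Fin.sum_univ_succ, Finset.univ_eq_empty,
    Finset.sum_empty]
  ring

theorem e10Quad_red (x : Fin 10 → ℤ) : e10Quad (red x) = ((e10Quad x : ℤ) : ZMod 2) := by
  simp [e10Quad, red]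

theorem q2_eq_e10Quad (v : Fin 10 → ZMod 2) : q2 v = e10Quad v := by
  have hv : red (fun i => ((v i).val : ℤ)) = v := by
    ext i
    simp [red]
  rw [q2, e10Form_self, Int.mul_ediv_cancel_left _ two_ne_zero, ← e10Quad_red, hv]

theorem red_add (x y : Fin 10 → ℤ) : red (x + y) = red x + red y := by
  ext i
  simp [red]

/-- The polar form of `q2` is the reduction of the form of `E₁₀`. -/
theorem q2_red_add (x y : Fin 10 → ℤ) :
    q2 (red x + red y) = q2 (red x) + q2 (red y) + (e10Form x y : ZMod 2) := by
  simp only [← red_add, q2_eq_e10Quad, e10Quad_red, e10Quad_add, Int.cast_add]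

theorem red_sum_smul {ι : Type*} [Fintype ι] (c : ι → ℤ) (d : ι → Fin 10 → ℤ) :
    red (∑ i, c i • d i) = ∑ i, (c i : ZMod 2) • red (d i) := by
  ext j
  simp [red, Finset.sum_apply]

theorem red_two_nsmul (x : Fin 10 → ℤ) : red (2 • x) = 0 := by
  ext j
  simp [red, show (2 : ZMod 2) = 0 from rfl]

theorem exists_eq_add_two_smul {x y : Fin 10 → ℤ} (h : red x = red y) :
    ∃ w : Fin 10 → ℤ, x = y + (2 : ℤ) • w := by
  have hj (j : Fin 10) : ∃ w : ℤ, x j = y j + 2 * w := by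
    have h1 : ((y j : ℤ) : ZMod 2) = (x j : ℤ) := (congrFun h j).symm
    obtain ⟨w, hw⟩ := (ZMod.intCast_eq_intCast_iff_dvd_sub _ _ 2).1 h1
    exact ⟨w, by push_cast at hw; omega⟩
  choose w hw using hj
  exact ⟨w, funext hw⟩

/-- Roots with product `0` or `1` are not congruent modulo 2. -/
theorem red_ne_red_of_roots {x y : Fin 10 → ℤ} (hx : e10Form x x = -2)
    (hy : e10Form y y = -2) (hxy : e10Form x y = 0 ∨ e10Form x y = 1) : red x ≠ red y := by
  intro h
  obtain ⟨w, rfl⟩ := exists_eq_add_two_smul h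
  rw [e10Form_self, e10Quad_add] at hx
  have hw : e10Quad ((2 : ℤ) • w) = 4 * e10Quad w := by
    have h1 := e10Form_self ((2 : ℤ) • w)
    have h2 := e10Form_self w
    have h3 : e10Form ((2 : ℤ) • w) ((2 : ℤ) • w) = 4 * e10Form w w := by
      simp only [e10Form, smul_dotProduct, mulVec_smul, dotProduct_smul, smul_eq_mul]
      ring
    linarith
  have h4 : e10Form y ((2 : ℤ) • w) = 2 * e10Form y w := by
    simp only [e10Form, mulVec_smul, dotProduct_smul, smul_eq_mul]
  have h5 : e10Form w y = e10Form y w := by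
    simp only [e10Form_eq, mul_comm (w _)]
    ring
  rw [e10Form_add_left, e10Form_smul_left, hy, h5] at hxy
  rw [e10Form_self] at hy
  rw [hw, h4] at hx
  omega

/-- An automorphism of the `D₈` diagram is trivial up to exchanging the two short arms. -/
theorem d8Adj_automorphism {σ : Fin 8 → Fin 8} (hσ : Function.Injective σ)
    (hadj : ∀ i j : Fin 8, d8Adj i j → d8Adj (σ i) (σ j)) :
    (∀ i, 2 ≤ i → σ i = i) ∧ (σ 0 = 0 ∧ σ 1 = 1 ∨ σ 0 = 1 ∧ σ 1 = 0) := by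
  have branch : ∀ v a b c : Fin 8, a ≠ b → a ≠ c → b ≠ c → d8Adj a v → d8Adj b v →
      d8Adj c v → v = 2 := by decide
  have neighbor : ∀ a b : Fin 8, d8Adj 2 a → d8Adj a b → b ≠ 2 → a = 3 := by decide
  have next : ∀ a k : Fin 8, 3 ≤ k → k ≤ 6 → d8Adj k a → a ≠ k - 1 → a = k + 1 := by decide
  have arms : ∀ a b : Fin 8, d8Adj a 2 → d8Adj b 2 → a ≠ b → a ≠ 3 → b ≠ 3 →
      a = 0 ∧ b = 1 ∨ a = 1 ∧ b = 0 := by decide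
  have h2 : σ 2 = 2 := branch _ (σ 0) (σ 1) (σ 3) (hσ.ne (by decide)) (hσ.ne (by decide))
    (hσ.ne (by decide)) (hadj _ _ (by decide)) (hadj _ _ (by decide)) (hadj _ _ (by decide))
  have h3 : σ 3 = 3 := by
    have h := hadj 2 3 (by decide)
    rw [h2] at h
    exact neighbor _ (σ 4) h (hadj _ _ (by decide)) (h2 ▸ hσ.ne (by decide))
  have step (k : Fin 8) (hk : 3 ≤ k) (hk' : k ≤ 6) (h : σ k = k) (h' : σ (k - 1) = k - 1) :
      σ (k + 1) = k + 1 := by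
    have chain : ∀ k : Fin 8, 3 ≤ k → k ≤ 6 → d8Adj k (k + 1 : Fin 8) ∧ k + 1 ≠ k - 1 := by
      decide
    have hs := hadj k (k + 1) (chain k hk hk').1
    rw [h] at hs
    exact next _ k hk hk' hs (fun e => (chain k hk hk').2 (hσ (e.trans h'.symm)))
  have h4 : σ 4 = 4 := step 3 (by decide) (by decide) h3 h2
  have h5 : σ 5 = 5 := step 4 (by decide) (by decide) h4 h3
  have h6 : σ 6 = 6 := step 5 (by decide) (by decide) h5 h4
  have h7 : σ 7 = 7 := step 6 (by decide) (by decide) h6 h5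
  refine ⟨?_, ?_⟩
  · intro i hi
    fin_cases i <;> first | assumption | exact absurd hi (by decide)
  · have e0 := hadj 0 2 (by decide)
    have e1 := hadj 1 2 (by decide)
    rw [h2] at e0 e1
    exact arms _ _ e0 e1 (hσ.ne (by decide)) (h3 ▸ hσ.ne (by decide)) (h3 ▸ hσ.ne (by decide))

/-- A submodule of index two contains the double of some vector outside it. -/
theorem exists_notMem_two_nsmul_mem {M : Type*} [AddCommGroup M] (R' R : Submodule ℤ M)
    (h : Nat.card (↥R' ⧸ Submodule.comap R'.subtype R) = 2) : ∃ x, x ∉ R ∧ 2 • x ∈ R := by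
  have hne : Submodule.comap R'.subtype R ≠ ⊤ := by
    intro htop
    have := Submodule.Quotient.subsingleton_iff.2 htop
    simp at h
  obtain ⟨x, -, hx⟩ := SetLike.exists_of_lt hne.lt_top
  refine ⟨x, hx, ?_⟩
  have h0 : 2 • Submodule.Quotient.mk (p := Submodule.comap R'.subtype R) x = 0 := by
    rw [← h]
    exact card_nsmul_eq_zero'
  rw [← Submodule.Quotient.mk_smul, Submodule.Quotient.mk_eq_zero] at h0
  simpa using h0

theorem mem_of_two_nsmul_eq_sum {ι : Type*} [Fintype ι] {d : ι → Fin 10 → ℤ} {c : ι → ℤ}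
    {x : Fin 10 → ℤ} (hc : ∑ i, c i • d i = 2 • x) (heven : ∀ i, c i % 2 = 0) :
    x ∈ Submodule.span ℤ (Set.range d) := by
  rw [Submodule.mem_span_range_iff_exists_fun]
  refine ⟨fun i => c i / 2, ?_⟩
  apply nsmul_right_injective (two_ne_zero : 2 ≠ 0)
  dsimp only
  rw [← hc, Finset.smul_sum]
  refine Finset.sum_congr rfl fun i _ => ?_
  rw [← natCast_zsmul, smul_smul]
  congr 1
  have := heven i
  push_cast
  omega

/-- A half of an integral combination of `D₈` roots that is not itself such a combination
yields a spinor relation modulo 2. -/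
theorem spinor_relation {d : Fin 8 → Fin 10 → ℤ} (hroots : ∀ i, e10Form (d i) (d i) = -2)
    (hpattern : ∀ i j : Fin 8, i ≠ j →
      e10Form (d i) (d j) = if d8Adj i.val j.val then 1 else 0)
    {x : Fin 10 → ℤ} (hx : x ∉ Submodule.span ℤ (Set.range d))
    (h2x : 2 • x ∈ Submodule.span ℤ (Set.range d)) (h01 : red (d 0) ≠ red (d 1)) :
    red (d 0) + red (d 3) + red (d 5) + red (d 7) = 0 ∨
      red (d 1) + red (d 3) + red (d 5) + red (d 7) = 0 := by
  obtain ⟨c, hc⟩ := Submodule.mem_span_range_iff_exists_fun ℤ |>.1 h2x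
  have hgram (i j : Fin 8) : e10Form (d i) (d j) =
      if i = j then -2 else if d8Adj i.val j.val then 1 else 0 := by
    split_ifs with h h' <;> simp_all
  have hdual (j : Fin 8) : ∑ i, c i * (if i = j then -2 else if d8Adj i.val j.val then 1 else 0)
      = 2 * e10Form x (d j) := by
    have h := e10Form_sum_smul_left c d (d j)
    rw [hc, show 2 • x = (2 : ℤ) • x by simp, e10Form_smul_left] at h
    simpa only [hgram] using h.symm
  have hd0 := hdual 0
  have hd2 := hdual 2
  have hd3 := hdual 3
  have hd4 := hdual 4
  have hd5 := hdual 5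
  have hd6 := hdual 6
  simp [Fin.sum_univ_eight, d8Adj] at hd0 hd2 hd3 hd4 hd5 hd6
  have hred := red_sum_smul c d
  rw [hc, red_two_nsmul, Fin.sum_univ_eight] at hred
  have even {n : ℤ} (h : n % 2 = 0) : (n : ZMod 2) = 0 :=
    (ZMod.intCast_zmod_eq_zero_iff_dvd n 2).2 (by omega)
  have odd {n : ℤ} (h : n % 2 = 1) : (n : ZMod 2) = 1 := by
    rw [ZMod.intCast_eq_one_iff_odd]
    exact Int.odd_iff.2 h
  have e2 : c 2 % 2 = 0 := by omega
  have e4 : c 4 % 2 = 0 := by omega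
  have e6 : c 6 % 2 = 0 := by omega
  have e3 : c 3 % 2 = (c 0 + c 1) % 2 := by omega
  have e5 : c 5 % 2 = (c 0 + c 1) % 2 := by omega
  have e7 : c 7 % 2 = (c 0 + c 1) % 2 := by omega
  clear hd0 hd2 hd3 hd4 hd5 hd6 hdual hgram
  rw [even e2, even e4, even e6] at hred
  rcases Int.emod_two_eq_zero_or_one (c 0) with h0 | h0 <;>
    rcases Int.emod_two_eq_zero_or_one (c 1) with h1 | h1
  · have hall (i : Fin 8) : c i % 2 = 0 := by
      fin_cases i <;> simp only [Fin.reduceFinMk, Fin.zero_eta, Fin.mk_one] <;> omega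
    exact absurd (mem_of_two_nsmul_eq_sum hc hall) hx
  · rw [even h0, odd h1, odd (n := c 3) (by omega), odd (n := c 5) (by omega),
      odd (n := c 7) (by omega)] at hred
    right
    simpa using hred.symm
  · rw [odd h0, even h1, odd (n := c 3) (by omega), odd (n := c 5) (by omega),
      odd (n := c 7) (by omega)] at hred
    left
    simpa using hred.symm
  · rw [odd h0, odd h1, even (n := c 3) (by omega), even (n := c 5) (by omega),
      even (n := c 7) (by omega)] at hred
    refine absurd ?_ h01
    simp only [one_smul, zero_smul, add_zero] at hred
    rw [← sub_eq_zero, CharTwo.sub_eq_add]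
    exact hred.symm

/-- Let `B = {d₁,…,d₈} ⊆ E₁₀` be roots forming a `D₈` Dynkin diagram, let
`R = ⟨B⟩` with primitive closure `R'` and assume `[R' : R] = 2` (type `(D₈, E₈)`). Then
every isometry of `(F₂^10, q)` preserving `B̄` setwise and `R̄'` setwise fixes `B̄`
pointwise. -/
theorem d8e8_stabilizer (d : Fin 8 → (Fin 10 → ℤ))
    (hrootsB : ∀ i, e10Form (d i) (d i) = -2)
    (hpattern : ∀ i j : Fin 8, i ≠ j →
      e10Form (d i) (d j) = if d8Adj i.val j.val then 1 else 0)
    (R' : Submodule ℤ (Fin 10 → ℤ))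
    (hR' : ∀ x : Fin 10 → ℤ, x ∈ R' ↔
      ∃ c : ℤ, c ≠ 0 ∧ c • x ∈ Submodule.span ℤ (Set.range d))
    (hindex : Nat.card
      (↥R' ⧸ Submodule.comap R'.subtype (Submodule.span ℤ (Set.range d))) = 2) :
    ∀ f : (Fin 10 → ZMod 2) ≃ₗ[ZMod 2] (Fin 10 → ZMod 2),
      (∀ v, q2 (f v) = q2 v) →
      (⇑f) '' (red '' Set.range d) = red '' Set.range d →
      (⇑f) '' (red '' (R' : Set (Fin 10 → ℤ))) = red '' (R' : Set (Fin 10 → ℤ)) →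
      ∀ v ∈ red '' Set.range d, f v = v := by
  intro f hf hB _
  have hinj : Function.Injective (fun i => red (d i)) := by
    intro i j hij
    by_contra hne
    refine red_ne_red_of_roots (hrootsB i) (hrootsB j) ?_ hij
    rw [hpattern i j hne]
    split_ifs <;> simp
  have hσ (i : Fin 8) : ∃ j, f (red (d i)) = red (d j) := by
    have h : f (red (d i)) ∈ red '' Set.range d :=
      hB ▸ Set.mem_image_of_mem f (Set.mem_image_of_mem red (Set.mem_range_self i))
    obtain ⟨_, ⟨j, rfl⟩, hj⟩ := h
    exact ⟨j, hj.symm⟩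
  choose σ hσ using hσ
  have hσinj : Function.Injective σ := by
    intro i j hij
    apply hinj
    apply f.injective
    simp only [hσ, hij]
  have hform (i j : Fin 8) :
      (e10Form (d (σ i)) (d (σ j)) : ZMod 2) = (e10Form (d i) (d j) : ZMod 2) := by
    have h := q2_red_add (d (σ i)) (d (σ j))
    rw [← hσ, ← hσ, ← map_add, hf, hf, hf, q2_red_add] at h
    exact (add_left_cancel h).symm
  have hadj (i j : Fin 8) (h : d8Adj i j) : d8Adj (σ i) (σ j) := by
    have hij : i ≠ j := by
      rintro rfl
      unfold d8Adj at h
      omega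
    have h' := hform i j
    rw [hpattern i j hij, hpattern _ _ (hσinj.ne hij), if_pos h] at h'
    by_contra hn
    simp [hn] at h'
  obtain ⟨hfix, harms⟩ := d8Adj_automorphism hσinj hadj
  have h01 : red (d 0) ≠ red (d 1) := hinj.ne (by decide)
  have hswap : ¬ (σ 0 = 1 ∧ σ 1 = 0) := by
    rintro ⟨h0, h1⟩
    obtain ⟨x, hx, h2x⟩ := exists_notMem_two_nsmul_mem R' _ hindex
    have hrel := spinor_relation hrootsB hpattern hx h2x h01
    have hmap (a b : Fin 8) (hab : σ a = b)
        (h : red (d a) + red (d 3) + red (d 5) + red (d 7) = 0) :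
        red (d b) + red (d 3) + red (d 5) + red (d 7) = 0 := by
      have := congrArg f h
      simpa only [map_add, map_zero, hσ, hab, hfix 3 (by decide), hfix 5 (by decide),
        hfix 7 (by decide)] using this
    have hboth : red (d 0) + red (d 3) + red (d 5) + red (d 7) =
        red (d 1) + red (d 3) + red (d 5) + red (d 7) := by
      rcases hrel with h | h
      · rw [h, hmap 0 1 h0 h]
      · rw [h, hmap 1 0 h1 h]
    exact h01 (by simpa using hboth)
  obtain ⟨h0, h1⟩ := harms.resolve_right hswap
  rintro _ ⟨_, ⟨i, rfl⟩, rfl⟩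
  rw [hσ]
  have : σ i = i := by
    by_cases hi : 2 ≤ i
    · exact hfix i hi
    · fin_cases i <;> first | assumption | exact absurd (by decide) hi
  rw [this]
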